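/- arXiv:math/0411658 — 2 statements merged into one kernel-verified Lean document; each statement's English description precedes it below -/
import Mathlib

section
/- If φ is a null state for the form a, then φ is a distributional solution of Lφ = 0 in Ω: for every ψ ∈ C_c^∞(Ω;ℝ) one has ∫_Ω φ(x) ( −div(A∇ψ)(x) + V(x)ψ(x) ) dx = 0. -/
open MeasureTheory Set Filter Topology

noncomputable section

/-- `u` is a real-valued smooth function compactly supported in `Ω`. -/
def IsSmoothCS {d : ℕ} (Ω : Set (EuclideanSpace ℝ (Fin d)))
    (u : EuclideanSpace ℝ (Fin d) → ℝ) : Prop :=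
  ContDiff ℝ (⊤ : ℕ∞) u ∧ HasCompactSupport u ∧ tsupport u ⊆ Ω

/-- The quadratic form `a[u] = ∫_Ω (A ∇u · ∇u + V u²) dx`. -/
def quadForm {d : ℕ} (Ω : Set (EuclideanSpace ℝ (Fin d)))
    (A : EuclideanSpace ℝ (Fin d) → Matrix (Fin d) (Fin d) ℝ)
    (V : EuclideanSpace ℝ (Fin d) → ℝ)
    (u : EuclideanSpace ℝ (Fin d) → ℝ) : ℝ :=
  ∫ x in Ω, ((∑ i, ∑ j, A x i j * gradient u x i * gradient u x j) + V x * (u x) ^ 2)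

/-- Convergence in `L²_loc(Ω)`. -/
def TendstoL2loc {d : ℕ} (Ω : Set (EuclideanSpace ℝ (Fin d)))
    (φk : ℕ → EuclideanSpace ℝ (Fin d) → ℝ) (φ : EuclideanSpace ℝ (Fin d) → ℝ) : Prop :=
  ∀ K : Set (EuclideanSpace ℝ (Fin d)), K ⊆ Ω → IsCompact K →
    Tendsto (fun k => ∫ x in K, (φk k x - φ x) ^ 2) atTop (nhds 0)

/-- `φ` is a null state for the form `a`: `φ ∈ L²_loc(Ω)`, `φ > 0` a.e. in `Ω`, and some
null sequence (`a[φ_k] → 0`) of test functions converges to `φ` in `L²_loc(Ω)`. -/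
def IsNullState {d : ℕ} (Ω : Set (EuclideanSpace ℝ (Fin d)))
    (A : EuclideanSpace ℝ (Fin d) → Matrix (Fin d) (Fin d) ℝ)
    (V : EuclideanSpace ℝ (Fin d) → ℝ)
    (φ : EuclideanSpace ℝ (Fin d) → ℝ) : Prop :=
  (∀ K : Set (EuclideanSpace ℝ (Fin d)), K ⊆ Ω → IsCompact K →
      IntegrableOn (fun x => (φ x) ^ 2) K) ∧
  (∀ᵐ x ∂(volume.restrict Ω), 0 < φ x) ∧
  ∃ φk : ℕ → EuclideanSpace ℝ (Fin d) → ℝ,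
    (∀ k, IsSmoothCS Ω (φk k)) ∧
    Tendsto (fun k => quadForm Ω A V (φk k)) atTop (nhds 0) ∧
    TendstoL2loc Ω φk φ

/-- The form `a` has a weighted spectral gap: a continuous `W > 0` on `Ω` with
`∫_Ω W u² ≤ a[u]` for all test functions. -/
def HasWeightedSpectralGap {d : ℕ} (Ω : Set (EuclideanSpace ℝ (Fin d)))
    (A : EuclideanSpace ℝ (Fin d) → Matrix (Fin d) (Fin d) ℝ)
    (V : EuclideanSpace ℝ (Fin d) → ℝ) : Prop :=
  ∃ W : EuclideanSpace ℝ (Fin d) → ℝ, ContinuousOn W Ω ∧ (∀ x ∈ Ω, 0 < W x) ∧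
    ∀ u, IsSmoothCS Ω u → ∫ x in Ω, W x * (u x) ^ 2 ≤ quadForm Ω A V u

/-- The Schrödinger operator `L u = -div(A ∇u) + V u`, evaluated pointwise. -/
def Lop {d : ℕ} (A : EuclideanSpace ℝ (Fin d) → Matrix (Fin d) (Fin d) ℝ)
    (V : EuclideanSpace ℝ (Fin d) → ℝ) (u : EuclideanSpace ℝ (Fin d) → ℝ)
    (x : EuclideanSpace ℝ (Fin d)) : ℝ :=
  -(∑ i, fderiv ℝ (fun y => ∑ j, A y i j * gradient u y j) x (EuclideanSpace.single i 1)) +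
    V x * u x

/-- The bilinear density `∇u · A ∇v + V u v`, whose integral polarizes `quadForm`. -/
def formDensity {d : ℕ} (A : EuclideanSpace ℝ (Fin d) → Matrix (Fin d) (Fin d) ℝ)
    (V : EuclideanSpace ℝ (Fin d) → ℝ) (u v : EuclideanSpace ℝ (Fin d) → ℝ)
    (x : EuclideanSpace ℝ (Fin d)) : ℝ :=
  (∑ i, gradient u x i * ∑ j, A x i j * gradient v x j) + V x * (u x * v x)

lemma gradient_apply_eq_fderiv_single {d : ℕ} (u : EuclideanSpace ℝ (Fin d) → ℝ)
    (x : EuclideanSpace ℝ (Fin d)) (i : Fin d) :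
    gradient u x i = fderiv ℝ u x (EuclideanSpace.single i 1) := by
  rw [gradient, ← InnerProductSpace.toDual_symm_apply (𝕜 := ℝ) (y := fderiv ℝ u x),
    EuclideanSpace.inner_single_right]
  simp

lemma tsupport_gradient_apply_subset {d : ℕ} (u : EuclideanSpace ℝ (Fin d) → ℝ) (i : Fin d) :
    tsupport (fun x => gradient u x i) ⊆ tsupport u := by
  simp only [gradient_apply_eq_fderiv_single]
  exact tsupport_fderiv_apply_subset ℝ _

lemma gradient_apply_eq_zero_of_notMem_tsupport {d : ℕ} {u : EuclideanSpace ℝ (Fin d) → ℝ}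
    {x : EuclideanSpace ℝ (Fin d)} (hx : x ∉ tsupport u) (i : Fin d) : gradient u x i = 0 := by
  simp [gradient_apply_eq_fderiv_single, fderiv_of_notMem_tsupport ℝ hx]

/-- A product is `C^n` as soon as one factor is `C^n` near the support of the other. -/
lemma ContDiffOn.mul_of_tsupport_subset {E : Type*} [NormedAddCommGroup E] [NormedSpace ℝ E]
    {n : WithTop ℕ∞} {Ω : Set E} (hΩ : IsOpen Ω) {f g : E → ℝ} (hf : ContDiffOn ℝ n f Ω)
    (hg : ContDiff ℝ n g) (hgΩ : tsupport g ⊆ Ω) : ContDiff ℝ n (fun x => f x * g x) := by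
  rw [contDiff_iff_contDiffAt]
  intro x
  by_cases hx : x ∈ tsupport g
  · exact (hf.contDiffAt (hΩ.mem_nhds (hgΩ hx))).mul hg.contDiffAt
  · refine (contDiffAt_const (c := (0 : ℝ))).congr_of_eventuallyEq ?_
    filter_upwards [notMem_tsupport_iff_eventuallyEq.mp hx] with y hy
    simp [hy]

lemma ContinuousOn.mul_of_tsupport_subset {E : Type*} [TopologicalSpace E]
    {Ω : Set E} (hΩ : IsOpen Ω) {f g : E → ℝ} (hf : ContinuousOn f Ω)
    (hg : Continuous g) (hgΩ : tsupport g ⊆ Ω) : Continuous (fun x => f x * g x) :=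
  continuous_of_tsupport fun _ hx =>
    (hf.continuousAt (hΩ.mem_nhds (hgΩ (tsupport_mul_subset_right hx)))).mul hg.continuousAt

lemma integral_const_mul_add_const_mul_add {α : Type*} [MeasurableSpace α] {μ : Measure α}
    {f g h : α → ℝ} (hf : Integrable f μ) (hg : Integrable g μ) (hh : Integrable h μ) (a b : ℝ) :
    ∫ x, (a * f x + b * g x + h x) ∂μ = a * ∫ x, f x ∂μ + b * ∫ x, g x ∂μ + ∫ x, h x ∂μ := by
  have hfg : Integrable (fun x => a * f x + b * g x) μ := (hf.const_mul a).add (hg.const_mul b)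
  rw [integral_add hfg hh, integral_add (hf.const_mul a) (hg.const_mul b),
    integral_const_mul, integral_const_mul]

namespace IsSmoothCS

variable {d : ℕ} {Ω : Set (EuclideanSpace ℝ (Fin d))} {u v : EuclideanSpace ℝ (Fin d) → ℝ}

lemma add_const_mul (hu : IsSmoothCS Ω u) (hv : IsSmoothCS Ω v) (t : ℝ) :
    IsSmoothCS Ω (fun x => u x + t * v x) := by
  refine ⟨hu.1.add (contDiff_const.mul hv.1), hu.2.1.add hv.2.1.mul_left, ?_⟩
  refine (tsupport_add _ _).trans (union_subset hu.2.2 ?_)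
  exact tsupport_mul_subset_right.trans hv.2.2

lemma gradient_add_const_mul (hu : IsSmoothCS Ω u) (hv : IsSmoothCS Ω v) (t : ℝ)
    (x : EuclideanSpace ℝ (Fin d)) (i : Fin d) :
    gradient (fun x => u x + t * v x) x i = gradient u x i + t * gradient v x i := by
  have hu' : DifferentiableAt ℝ u x := hu.1.differentiable (by simp) x
  have hv' : DifferentiableAt ℝ v x := hv.1.differentiable (by simp) x
  simp only [gradient_apply_eq_fderiv_single]
  rw [fderiv_fun_add hu' (hv'.const_mul t), fderiv_const_mul hv' t]
  simp

lemma contDiff_gradient_apply (hu : IsSmoothCS Ω u) (i : Fin d) :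
    ContDiff ℝ 1 (fun x => gradient u x i) := by
  simp only [gradient_apply_eq_fderiv_single]
  exact ((contDiff_infty.1 hu.1 2).fderiv_right (m := 1) (by norm_num)).clm_apply contDiff_const

lemma contDiff_flux {A : EuclideanSpace ℝ (Fin d) → Matrix (Fin d) (Fin d) ℝ} (hΩ : IsOpen Ω)
    (hA : ∀ i j, ContDiffOn ℝ 1 (fun x => A x i j) Ω) (hu : IsSmoothCS Ω u) (i : Fin d) :
    ContDiff ℝ 1 (fun x => ∑ j, A x i j * gradient u x j) :=
  ContDiff.sum fun j _ => (hA i j).mul_of_tsupport_subset hΩ (hu.contDiff_gradient_apply j)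
    ((tsupport_gradient_apply_subset u j).trans hu.2.2)

lemma flux_eq_zero (A : EuclideanSpace ℝ (Fin d) → Matrix (Fin d) (Fin d) ℝ)
    {x : EuclideanSpace ℝ (Fin d)} (hx : x ∉ tsupport u) (i : Fin d) :
    ∑ j, A x i j * gradient u x j = 0 :=
  Finset.sum_eq_zero fun j _ => by
    rw [gradient_apply_eq_zero_of_notMem_tsupport hx, mul_zero]

lemma tsupport_flux_subset (A : EuclideanSpace ℝ (Fin d) → Matrix (Fin d) (Fin d) ℝ)
    (i : Fin d) : tsupport (fun x => ∑ j, A x i j * gradient u x j) ⊆ tsupport u :=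
  closure_minimal (fun _ hx => by_contra fun h => hx (flux_eq_zero A h i)) (isClosed_tsupport u)

lemma Lop_eq_zero (A : EuclideanSpace ℝ (Fin d) → Matrix (Fin d) (Fin d) ℝ)
    (V : EuclideanSpace ℝ (Fin d) → ℝ) {x : EuclideanSpace ℝ (Fin d)} (hx : x ∉ tsupport u) :
    Lop A V u x = 0 := by
  have h (i : Fin d) : fderiv ℝ (fun y => ∑ j, A y i j * gradient u y j) x = 0 :=
    fderiv_of_notMem_tsupport ℝ fun h => hx (tsupport_flux_subset A i h)
  simp [Lop, h, image_eq_zero_of_notMem_tsupport hx]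

lemma continuous_Lop {A : EuclideanSpace ℝ (Fin d) → Matrix (Fin d) (Fin d) ℝ}
    {V : EuclideanSpace ℝ (Fin d) → ℝ} (hΩ : IsOpen Ω)
    (hA : ∀ i j, ContDiffOn ℝ 1 (fun x => A x i j) Ω) (hV : ContinuousOn V Ω)
    (hu : IsSmoothCS Ω u) : Continuous (Lop A V u) := by
  refine Continuous.add (Continuous.neg (continuous_finsetSum _ fun i _ => ?_))
    (hV.mul_of_tsupport_subset hΩ hu.1.continuous hu.2.2)
  exact ((hu.contDiff_flux hΩ hA i).continuous_fderiv (by simp)).clm_apply continuous_const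

lemma formDensity_eq_zero (A : EuclideanSpace ℝ (Fin d) → Matrix (Fin d) (Fin d) ℝ)
    (V : EuclideanSpace ℝ (Fin d) → ℝ) {x : EuclideanSpace ℝ (Fin d)} (hx : x ∉ tsupport v) :
    formDensity A V u v x = 0 := by
  simp [formDensity, flux_eq_zero A hx, image_eq_zero_of_notMem_tsupport hx]

lemma integrable_formDensity {A : EuclideanSpace ℝ (Fin d) → Matrix (Fin d) (Fin d) ℝ}
    {V : EuclideanSpace ℝ (Fin d) → ℝ} (hΩ : IsOpen Ω)
    (hA : ∀ i j, ContDiffOn ℝ 1 (fun x => A x i j) Ω) (hV : ContinuousOn V Ω)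
    (hu : IsSmoothCS Ω u) (hv : IsSmoothCS Ω v) : Integrable (formDensity A V u v) := by
  refine Continuous.integrable_of_hasCompactSupport ?_
    (HasCompactSupport.intro hv.2.1 fun x hx => formDensity_eq_zero A V hx)
  refine Continuous.add (continuous_finsetSum _ fun i _ => ?_) ?_
  · exact (hu.contDiff_gradient_apply i).continuous.mul (hv.contDiff_flux hΩ hA i).continuous
  · exact hV.mul_of_tsupport_subset hΩ (hu.1.continuous.mul hv.1.continuous)
      (tsupport_mul_subset_right.trans hv.2.2)

lemma setIntegral_formDensity_eq {A : EuclideanSpace ℝ (Fin d) → Matrix (Fin d) (Fin d) ℝ}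
    {V : EuclideanSpace ℝ (Fin d) → ℝ} (hΩ : IsOpen Ω)
    (hA : ∀ i j, ContDiffOn ℝ 1 (fun x => A x i j) Ω) (hV : ContinuousOn V Ω)
    (hu : IsSmoothCS Ω u) (hv : IsSmoothCS Ω v) :
    ∫ x in Ω, formDensity A V u v x = ∫ x in Ω, u x * Lop A V v x := by
  rw [setIntegral_eq_integral_of_forall_compl_eq_zero
      fun x hx => formDensity_eq_zero A V fun h => hx (hv.2.2 h),
    setIntegral_eq_integral_of_forall_compl_eq_zero fun x hx => by
      rw [Lop_eq_zero A V fun h => hx (hv.2.2 h), mul_zero]]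
  have huc := hu.1.continuous
  have hF (i : Fin d) := hv.contDiff_flux hΩ hA i
  have hFc (i : Fin d) : HasCompactSupport (fun x => ∑ j, A x i j * gradient v x j) :=
    HasCompactSupport.intro hv.2.1 fun x hx => flux_eq_zero A hx i
  have hgrad (i : Fin d) :
      Integrable (fun x => gradient u x i * ∑ j, A x i j * gradient v x j) :=
    ((hu.contDiff_gradient_apply i).continuous.mul
      (hF i).continuous).integrable_of_hasCompactSupport (hFc i).mul_left
  have hdiv (i : Fin d) : Integrable (fun x => u x *
      fderiv ℝ (fun y => ∑ j, A y i j * gradient v y j) x (EuclideanSpace.single i 1)) :=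
    (huc.mul (((hF i).continuous_fderiv (by simp)).clm_apply
      continuous_const)).integrable_of_hasCompactSupport hu.2.1.mul_right
  have hpot : Integrable (fun x => V x * (u x * v x)) :=
    (hV.mul_of_tsupport_subset hΩ (huc.mul hv.1.continuous)
      (tsupport_mul_subset_right.trans hv.2.2)).integrable_of_hasCompactSupport
      hu.2.1.mul_right.mul_left
  have hparts (i : Fin d) : ∫ x, gradient u x i * ∑ j, A x i j * gradient v x j =
      -∫ x, u x *
        fderiv ℝ (fun y => ∑ j, A y i j * gradient v y j) x (EuclideanSpace.single i 1) := by
    have hg := hgrad i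
    simp only [gradient_apply_eq_fderiv_single u] at hg ⊢
    rw [integral_mul_fderiv_eq_neg_fderiv_mul_of_integrable hg (hdiv i)
      ((huc.mul (hF i).continuous).integrable_of_hasCompactSupport (hFc i).mul_left)
      (fun x _ => hu.1.differentiable (by simp) x)
      (fun x _ => (hF i).differentiable (by simp) x), neg_neg]
  have hLop (x : EuclideanSpace ℝ (Fin d)) : u x * Lop A V v x =
      -(∑ i, u x * fderiv ℝ (fun y => ∑ j, A y i j * gradient v y j) x
        (EuclideanSpace.single i 1)) + V x * (u x * v x) := by
    rw [Lop, ← Finset.mul_sum]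
    ring
  simp only [formDensity, hLop]
  have hneg : Integrable (fun x => -∑ i, u x * fderiv ℝ
      (fun y => ∑ j, A y i j * gradient v y j) x (EuclideanSpace.single i 1)) :=
    (integrable_finsetSum _ fun i _ => hdiv i).neg
  rw [integral_add (integrable_finsetSum _ fun i _ => hgrad i) hpot,
    integral_add hneg hpot, integral_neg,
    integral_finsetSum _ fun i _ => hgrad i, integral_finsetSum _ fun i _ => hdiv i]
  simp only [hparts, Finset.sum_neg_distrib]

lemma quadForm_add_const_mul {A : EuclideanSpace ℝ (Fin d) → Matrix (Fin d) (Fin d) ℝ}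
    {V : EuclideanSpace ℝ (Fin d) → ℝ} (hΩ : IsOpen Ω)
    (hA : ∀ i j, ContDiffOn ℝ 1 (fun x => A x i j) Ω) (hAs : ∀ x ∈ Ω, (A x).IsSymm)
    (hV : ContinuousOn V Ω) (hu : IsSmoothCS Ω u) (hv : IsSmoothCS Ω v) (t : ℝ) :
    quadForm Ω A V (fun x => u x + t * v x) = quadForm Ω A V v * (t * t) +
      2 * (∫ x in Ω, u x * Lop A V v x) * t + quadForm Ω A V u := by
  have hq (w : EuclideanSpace ℝ (Fin d) → ℝ) :
      quadForm Ω A V w = ∫ x in Ω, formDensity A V w w x := by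
    refine integral_congr_ae (Eventually.of_forall fun x => ?_)
    simp only [formDensity, Finset.mul_sum]
    congr 1
    · exact Finset.sum_congr rfl fun i _ => Finset.sum_congr rfl fun j _ => by ring
    · ring
  have hint {w z} (hw : IsSmoothCS Ω w) (hz : IsSmoothCS Ω z) :
      IntegrableOn (formDensity A V w z) Ω :=
    (integrable_formDensity hΩ hA hV hw hz).integrableOn
  have hexp : ∀ x ∈ Ω, formDensity A V (fun x => u x + t * v x) (fun x => u x + t * v x) x =
      (t * t) * formDensity A V v v x + (2 * t) * formDensity A V u v x +
        formDensity A V u u x := by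
    intro x hx
    have hsymm : ∑ i, gradient v x i * ∑ j, A x i j * gradient u x j =
        ∑ i, gradient u x i * ∑ j, A x i j * gradient v x j := by
      simp only [Finset.mul_sum]
      rw [Finset.sum_comm]
      refine Finset.sum_congr rfl fun i _ => Finset.sum_congr rfl fun j _ => ?_
      rw [(hAs x hx).apply i j]
      ring
    have hsum : ∑ i, (gradient u x i + t * gradient v x i) *
          ∑ j, A x i j * (gradient u x j + t * gradient v x j) =
        ∑ i, gradient u x i * ∑ j, A x i j * gradient u x j +
        t * ∑ i, gradient u x i * ∑ j, A x i j * gradient v x j +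
        t * ∑ i, gradient v x i * ∑ j, A x i j * gradient u x j +
        t * t * ∑ i, gradient v x i * ∑ j, A x i j * gradient v x j := by
      simp only [Finset.mul_sum, ← Finset.sum_add_distrib]
      exact Finset.sum_congr rfl fun i _ => Finset.sum_congr rfl fun j _ => by ring
    simp only [formDensity, gradient_add_const_mul hu hv]
    rw [hsum, hsymm]
    ring
  rw [hq, hq, hq, ← setIntegral_formDensity_eq hΩ hA hV hu hv,
    setIntegral_congr_fun hΩ.measurableSet hexp,
    integral_const_mul_add_const_mul_add (hint hv hv) (hint hu hv) (hint hu hu)]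
  ring

/-- The Cauchy–Schwarz inequality for the form, with the mixed term in strong form. -/
lemma sq_integral_mul_Lop_le {A : EuclideanSpace ℝ (Fin d) → Matrix (Fin d) (Fin d) ℝ}
    {V : EuclideanSpace ℝ (Fin d) → ℝ} (hΩ : IsOpen Ω)
    (hA : ∀ i j, ContDiffOn ℝ 1 (fun x => A x i j) Ω) (hAs : ∀ x ∈ Ω, (A x).IsSymm)
    (hV : ContinuousOn V Ω) (hnn : ∀ u, IsSmoothCS Ω u → 0 ≤ quadForm Ω A V u)
    (hu : IsSmoothCS Ω u) (hv : IsSmoothCS Ω v) :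
    (∫ x in Ω, u x * Lop A V v x) ^ 2 ≤ quadForm Ω A V u * quadForm Ω A V v := by
  have h := discrim_le_zero fun t => (hnn _ (hu.add_const_mul hv t)).trans_eq
    (quadForm_add_const_mul hΩ hA hAs hV hu hv t)
  rw [discrim] at h
  linarith

end IsSmoothCS

/-- The Cauchy–Schwarz inequality for real square-integrable functions. -/
lemma MeasureTheory.MemLp.sq_integral_mul_le {α : Type*} [MeasurableSpace α] {μ : Measure α}
    {f g : α → ℝ} (hf : MemLp f 2 μ) (hg : MemLp g 2 μ) :
    (∫ x, f x * g x ∂μ) ^ 2 ≤ (∫ x, f x ^ 2 ∂μ) * ∫ x, g x ^ 2 ∂μ := by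
  have hfg : Integrable (fun x => f x * g x) μ := hf.integrable_mul hg
  have h := discrim_le_zero (a := ∫ x, g x ^ 2 ∂μ) (b := 2 * ∫ x, f x * g x ∂μ)
    (c := ∫ x, f x ^ 2 ∂μ) fun t => by
      have h0 : 0 ≤ ∫ x, (f x + t * g x) ^ 2 ∂μ := integral_nonneg fun x => sq_nonneg _
      have he (x : α) : (f x + t * g x) ^ 2 =
          t * t * g x ^ 2 + 2 * t * (f x * g x) + f x ^ 2 := by ring
      simp only [he] at h0
      rw [integral_const_mul_add_const_mul_add hg.integrable_sq hfg hf.integrable_sq] at h0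
      linarith
  rw [discrim] at h
  linarith

lemma tendsto_zero_of_sq_tendsto_zero {ι : Type*} {l : Filter ι} {f : ι → ℝ}
    (h : Tendsto (fun k => f k ^ 2) l (𝓝 0)) : Tendsto f l (𝓝 0) := by
  rw [tendsto_zero_iff_abs_tendsto_zero]
  simpa [Function.comp_def, Real.sqrt_sq_eq_abs] using (Real.continuous_sqrt.tendsto 0).comp h

/-- A null state is a distributional solution of `Lφ = 0` in `Ω`. -/
theorem stmt3
    {d : ℕ} (hd : 1 ≤ d) (Ω : Set (EuclideanSpace ℝ (Fin d)))
    (hΩo : IsOpen Ω) (hΩc : IsConnected Ω)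
    (A : EuclideanSpace ℝ (Fin d) → Matrix (Fin d) (Fin d) ℝ)
    (hAsmooth : ∀ i j, ContDiffOn ℝ 1 (fun x => A x i j) Ω)
    (hAsymm : ∀ x ∈ Ω, (A x).IsSymm)
    (hAell : ∀ K : Set (EuclideanSpace ℝ (Fin d)), K ⊆ Ω → IsCompact K →
      ∃ lam : ℝ, 1 < lam ∧ ∀ x ∈ K, ∀ ξ : EuclideanSpace ℝ (Fin d),
        lam⁻¹ * ‖ξ‖ ^ 2 ≤ ∑ i, ∑ j, A x i j * ξ i * ξ j ∧
        ∑ i, ∑ j, A x i j * ξ i * ξ j ≤ lam * ‖ξ‖ ^ 2)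
    (V : EuclideanSpace ℝ (Fin d) → ℝ) (hVc : ContinuousOn V Ω)
    (hnn : ∀ u, IsSmoothCS Ω u → 0 ≤ quadForm Ω A V u)
    (φ : EuclideanSpace ℝ (Fin d) → ℝ) (hφ : IsNullState Ω A V φ) :
    ∀ ψ, IsSmoothCS Ω ψ → ∫ x in Ω, φ x * Lop A V ψ x = 0 := by
  intro ψ hψ
  obtain ⟨hφ2, hφpos, u, hu, hau, huφ⟩ := hφ
  set K := tsupport ψ
  have hK : IsCompact K := hψ.2.1
  have hKΩ : K ⊆ Ω := hψ.2.2
  have hg : Continuous (Lop A V ψ) := hψ.continuous_Lop hΩo hAsmooth hVc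
  have hrestrict (f : EuclideanSpace ℝ (Fin d) → ℝ) :
      ∫ x in Ω, f x * Lop A V ψ x = ∫ x in K, f x * Lop A V ψ x :=
    setIntegral_eq_of_subset_of_forall_sdiff_eq_zero hΩo.measurableSet hKΩ fun x hx => by
      rw [IsSmoothCS.Lop_eq_zero A V hx.2, mul_zero]
  have hmemLp {f : EuclideanSpace ℝ (Fin d) → ℝ} (hf : Continuous f) :
      MemLp f 2 (volume.restrict K) :=
    (memLp_two_iff_integrable_sq hf.aestronglyMeasurable).2
      ((hf.pow 2).continuousOn.integrableOn_compact hK)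
  have hφm : MemLp φ 2 (volume.restrict K) := by
    refine (memLp_two_iff_integrable_sq ?_).2 (hφ2 K hKΩ hK)
    refine (Real.continuous_sqrt.comp_aestronglyMeasurable
      (hφ2 K hKΩ hK).aestronglyMeasurable).congr ?_
    filter_upwards [ae_restrict_of_ae_restrict_of_subset hKΩ hφpos] with x hx
    exact Real.sqrt_sq hx.le
  have hform : Tendsto (fun k => ∫ x in K, u k x * Lop A V ψ x) atTop (𝓝 0) := by
    have h := squeeze_zero (fun k => sq_nonneg (∫ x in Ω, u k x * Lop A V ψ x))
      (fun k => (hu k).sq_integral_mul_Lop_le hΩo hAsmooth hAsymm hVc hnn hψ)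
      (by simpa using hau.mul_const (quadForm Ω A V ψ))
    simpa only [hrestrict] using (tendsto_zero_of_sq_tendsto_zero h)
  have hdiff : Tendsto (fun k => ∫ x in K, (u k x - φ x) * Lop A V ψ x) atTop (𝓝 0) := by
    have h := squeeze_zero (fun k => sq_nonneg (∫ x in K, (u k x - φ x) * Lop A V ψ x))
      (fun k => ((hmemLp (hu k).1.continuous).sub hφm).sq_integral_mul_le (hmemLp hg))
      (by simpa using (huφ K hKΩ hK).mul_const (∫ x in K, Lop A V ψ x ^ 2))
    exact tendsto_zero_of_sq_tendsto_zero h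
  rw [hrestrict]
  have hlim := hform.sub hdiff
  rw [sub_zero] at hlim
  refine tendsto_nhds_unique (tendsto_const_nhds.congr fun k => ?_) hlim
  have huk := hmemLp (hu k).1.continuous
  refine Eq.trans ?_ (integral_sub (huk.integrable_mul (hmemLp hg))
    ((huk.sub hφm).integrable_mul (hmemLp hg)))
  refine integral_congr_ae (Eventually.of_forall fun x => ?_)
  change φ x * _ = u k x * _ - (u k x - φ x) * _
  ring
end
end

section
/- Let d ≥ 3 and Ω = ℝ^d ∖ {0}. Then there exists a sequence φ_k ∈ C_c^∞(Ω;ℝ) such that ∫_Ω ( |∇φ_k|² − ((d−2)/2)² φ_k(x)²/|x|² ) dx → 0 and φ_k → φ in L²_loc(Ω), where φ(x) = |x|^{−(d−2)/2}. In other words, the Hardy form admits |x|^{−(d−2)/2} as a null state. -/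
open MeasureTheory Set Filter Topology

noncomputable section

/-- A fixed smooth cutoff on `ℝ`, equal to `1` on `[-1, 1]` and supported in `[-2, 2]`. -/
def lineCutoff : ContDiffBump (0 : ℝ) := ⟨1, 2, one_pos, one_lt_two⟩

lemma contDiff_lineCutoff : ContDiff ℝ (⊤ : ℕ∞) (lineCutoff : ℝ → ℝ) :=
  lineCutoff.contDiff

lemma hasDerivAt_lineCutoff (t : ℝ) :
    HasDerivAt (lineCutoff : ℝ → ℝ) (deriv lineCutoff t) t :=
  ((contDiff_lineCutoff.differentiable (by simp)) t).hasDerivAt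

lemma continuous_deriv_lineCutoff : Continuous (deriv (lineCutoff : ℝ → ℝ)) :=
  contDiff_lineCutoff.continuous_deriv (by simp)

lemma lineCutoff_eq_one {t : ℝ} (ht : |t| ≤ 1) : lineCutoff t = 1 :=
  lineCutoff.one_of_mem_closedBall (by simpa [lineCutoff, Real.norm_eq_abs] using ht)

lemma lineCutoff_eq_zero {t : ℝ} (ht : 2 ≤ |t|) : lineCutoff t = 0 :=
  lineCutoff.zero_of_le_dist (by simpa [lineCutoff, Real.dist_eq] using ht)

/-- The substitution `r = exp t` in a logarithmically homogeneous integral. -/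
lemma integral_Ioi_inv_mul_comp_log (h : ℝ → ℝ) :
    ∫ r in Ioi (0 : ℝ), r⁻¹ * h (Real.log r) = ∫ t, h t := by
  have key := integral_image_eq_integral_abs_deriv_smul (s := univ) (f := Real.exp)
    (f' := Real.exp) MeasurableSet.univ
    (fun t _ => (Real.hasDerivAt_exp t).hasDerivWithinAt) Real.exp_injective.injOn
    (fun r => r⁻¹ * h (Real.log r))
  rw [image_univ, Real.range_exp] at key
  rw [key, setIntegral_univ]
  refine integral_congr_ae (Eventually.of_forall fun t => ?_)
  simp only [abs_of_pos (Real.exp_pos t), Real.log_exp, smul_eq_mul]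
  field_simp

/-- The logarithmic cutoff of the power `r ^ (-s)`, equal to it where `|log r| ≤ n` and
vanishing where `|log r| ≥ 2 n`. -/
def logCutoffPow (s n r : ℝ) : ℝ := r ^ (-s) * lineCutoff (Real.log r / n)

lemma hasDerivAt_logCutoffPow (s n : ℝ) {r : ℝ} (hr : 0 < r) :
    HasDerivAt (logCutoffPow s n)
      (r ^ (-s) / r * (deriv lineCutoff (Real.log r / n) / n - s * lineCutoff (Real.log r / n)))
      r := by
  have h1 := Real.hasDerivAt_rpow_const (x := r) (p := -s) (Or.inl hr.ne')
  have h2 := (hasDerivAt_lineCutoff (Real.log r / n)).comp r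
    ((Real.hasDerivAt_log hr.ne').div_const n)
  refine (h1.mul h2).congr_deriv ?_
  rw [Real.rpow_sub_one hr.ne']
  simp only [Function.comp_apply]
  field_simp
  ring

lemma logCutoffPow_eq_zero {s n r : ℝ} (hs : s ≠ 0) (hn : 0 < n) (hr : 0 ≤ r)
    (h : r ∉ Icc (Real.exp (-(2 * n))) (Real.exp (2 * n))) : logCutoffPow s n r = 0 := by
  rcases hr.eq_or_lt with rfl | hr
  · simp [logCutoffPow, Real.zero_rpow (neg_ne_zero.mpr hs)]
  · rw [logCutoffPow, lineCutoff_eq_zero, mul_zero]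
    by_contra! hlt
    rw [abs_div, abs_of_pos hn, div_lt_iff₀ hn, abs_lt] at hlt
    exact h ⟨((Real.lt_log_iff_exp_lt hr).mp hlt.1).le, ((Real.log_lt_iff_lt_exp hr).mp hlt.2).le⟩

lemma contDiffAt_logCutoffPow (s n : ℝ) {r : ℝ} (hr : 0 < r) :
    ContDiffAt ℝ (⊤ : ℕ∞) (logCutoffPow s n) r :=
  (Real.contDiffAt_rpow_const_of_ne hr.ne').mul
    (contDiff_lineCutoff.contDiffAt.comp r ((Real.contDiffAt_log.mpr hr.ne').div_const n))

lemma isSmoothCS_logCutoffPow_norm {d : ℕ} {s n : ℝ} (hs : s ≠ 0) (hn : 0 < n) :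
    IsSmoothCS ({0}ᶜ : Set (EuclideanSpace ℝ (Fin d))) (fun x => logCutoffPow s n ‖x‖) := by
  set S : Set (EuclideanSpace ℝ (Fin d)) :=
    norm ⁻¹' Icc (Real.exp (-(2 * n))) (Real.exp (2 * n)) with hS
  have hSc : IsClosed S := isClosed_Icc.preimage continuous_norm
  have hSk : IsCompact S := by
    refine (isCompact_closedBall (0 : EuclideanSpace ℝ (Fin d)) (Real.exp (2 * n))).of_isClosed_subset
      hSc fun x hx => ?_
    simpa using hx.2
  have h0 : (0 : EuclideanSpace ℝ (Fin d)) ∉ S := fun h =>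
    (Real.exp_pos (-(2 * n))).not_ge (by simpa using h.1)
  have hzero : ∀ x ∉ S, logCutoffPow s n ‖x‖ = 0 := fun x hx =>
    logCutoffPow_eq_zero hs hn (norm_nonneg x) hx
  have hsupp : tsupport (fun x : EuclideanSpace ℝ (Fin d) => logCutoffPow s n ‖x‖) ⊆ S :=
    closure_minimal (fun x hx => by_contra fun h => hx (hzero x h)) hSc
  refine ⟨contDiff_iff_contDiffAt.mpr fun x => ?_, HasCompactSupport.intro hSk hzero,
    fun x hx h => h0 ?_⟩
  · rcases eq_or_ne x 0 with rfl | hx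
    · refine (contDiffAt_const (c := (0 : ℝ))).congr_of_eventuallyEq ?_
      filter_upwards [hSc.isOpen_compl.mem_nhds h0] with x hx using hzero x hx
    · exact (contDiffAt_logCutoffPow s n (norm_pos_iff.mpr hx)).comp x (contDiffAt_norm ℝ hx)
  · rw [mem_singleton_iff] at h
    exact h ▸ hsupp hx

lemma norm_gradient_comp_norm {E : Type*} [NormedAddCommGroup E] [InnerProductSpace ℝ E]
    [CompleteSpace E] {f : ℝ → ℝ} {f' : ℝ} {x : E} (hx : x ≠ 0) (hf : HasDerivAt f f' ‖x‖) :
    ‖gradient (fun y => f ‖y‖) x‖ = |f'| := by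
  have hd : DifferentiableAt ℝ (norm : E → ℝ) x := (contDiffAt_norm ℝ hx).differentiableAt one_ne_zero
  have : Nontrivial E := ⟨x, 0, hx⟩
  have h := (hf.comp_hasFDerivAt x hd.hasFDerivAt).fderiv
  simp only [Function.comp_def] at h
  rw [gradient, LinearIsometryEquiv.norm_map, h, norm_smul, norm_fderiv_norm hd, mul_one,
    Real.norm_eq_abs]

/-- The Hardy energy density of the truncated virtual ground state. -/
lemma hardy_density_logCutoffPow {d : ℕ} (n : ℝ) {x : EuclideanSpace ℝ (Fin d)} (hx : x ≠ 0) :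
    ‖gradient (fun y => logCutoffPow (((d : ℝ) - 2) / 2) n ‖y‖) x‖ ^ 2
        - ((d : ℝ) - 2) ^ 2 / 4 * (logCutoffPow (((d : ℝ) - 2) / 2) n ‖x‖) ^ 2 / ‖x‖ ^ 2
      = (‖x‖ ^ d)⁻¹ * ((deriv lineCutoff (Real.log ‖x‖ / n)) ^ 2 / n ^ 2
          - ((d : ℝ) - 2) / 2 * (2 * lineCutoff (Real.log ‖x‖ / n)
            * (deriv lineCutoff (Real.log ‖x‖ / n) / n))) := by
  have hr : 0 < ‖x‖ := norm_pos_iff.mpr hx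
  have hpow : (‖x‖ ^ (-(((d : ℝ) - 2) / 2))) ^ 2 = (‖x‖ ^ d)⁻¹ * ‖x‖ ^ 2 := by
    rw [← Real.rpow_mul_natCast hr.le, ← Real.rpow_natCast ‖x‖ d, ← Real.rpow_natCast ‖x‖ 2,
      ← Real.rpow_neg hr.le, ← Real.rpow_add hr]
    congr 1
    push_cast
    ring
  rw [norm_gradient_comp_norm hx (hasDerivAt_logCutoffPow _ n hr), sq_abs, logCutoffPow, mul_pow,
    mul_pow, div_pow, hpow, ← div_pow]
  generalize deriv lineCutoff (Real.log ‖x‖ / n) / n = D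
  field_simp
  ring

lemma integral_lineCutoff_energy (c : ℝ) {n : ℝ} (hn : 0 < n) :
    ∫ t, ((deriv lineCutoff (t / n)) ^ 2 / n ^ 2
        - c * (2 * lineCutoff (t / n) * (deriv lineCutoff (t / n) / n)))
      = n⁻¹ * ∫ t, (deriv lineCutoff t) ^ 2 := by
  have hcs : HasCompactSupport (deriv (lineCutoff : ℝ → ℝ)) := lineCutoff.hasCompactSupport.deriv
  have hI1 : Integrable fun t : ℝ => (deriv lineCutoff (t / n)) ^ 2 := by
    have : Integrable fun t : ℝ => (deriv lineCutoff t) ^ 2 :=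
      (continuous_deriv_lineCutoff.pow 2).integrable_of_hasCompactSupport
        (by simpa only [sq] using hcs.mul_left (f := deriv lineCutoff))
    exact this.comp_div hn.ne'
  have hI2 : Integrable fun t : ℝ => 2 * lineCutoff (t / n) * (deriv lineCutoff (t / n) / n) := by
    have : Integrable fun t : ℝ => 2 * lineCutoff t * (deriv lineCutoff t / n) := by
      refine Continuous.integrable_of_hasCompactSupport
        ((continuous_const.mul lineCutoff.continuous).mul
          (continuous_deriv_lineCutoff.div_const n)) ?_
      exact HasCompactSupport.mul_left (f := fun t => 2 * lineCutoff t)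
        (hcs.comp_left (g := fun y => y / n) (zero_div n))
    exact this.comp_div hn.ne'
  have hI3 : Integrable fun t : ℝ => lineCutoff (t / n) ^ 2 := by
    have : Integrable fun t : ℝ => lineCutoff t ^ 2 :=
      (lineCutoff.continuous.pow 2).integrable_of_hasCompactSupport
        (by simpa only [sq] using lineCutoff.hasCompactSupport.mul_left (f := lineCutoff))
    exact this.comp_div hn.ne'
  have hzero : ∫ t, 2 * lineCutoff (t / n) * (deriv lineCutoff (t / n) / n) = 0 := by
    refine integral_eq_zero_of_hasDerivAt_of_integrable (f := fun t => lineCutoff (t / n) ^ 2)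
      (fun t => ?_) hI2 hI3
    refine (((hasDerivAt_lineCutoff (t / n)).comp t
      ((hasDerivAt_id t).div_const n)).pow 2).congr_deriv ?_
    simp [div_eq_mul_inv]
  rw [integral_sub (hI1.div_const _) (hI2.const_mul c), integral_const_mul, hzero, mul_zero,
    sub_zero, integral_div, Measure.integral_comp_div (fun t => (deriv lineCutoff t) ^ 2),
    abs_of_pos hn, smul_eq_mul]
  field_simp

/-- The Hardy energy of the truncated virtual ground state. -/
lemma hardy_energy_logCutoffPow {d : ℕ} (hd : d ≠ 0) {n : ℝ} (hn : 0 < n) :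
    ∫ x in ({0}ᶜ : Set (EuclideanSpace ℝ (Fin d))),
        (‖gradient (fun y => logCutoffPow (((d : ℝ) - 2) / 2) n ‖y‖) x‖ ^ 2
          - ((d : ℝ) - 2) ^ 2 / 4 * (logCutoffPow (((d : ℝ) - 2) / 2) n ‖x‖) ^ 2 / ‖x‖ ^ 2)
      = d * (volume.real (Metric.ball (0 : EuclideanSpace ℝ (Fin d)) 1)
          * (n⁻¹ * ∫ t, (deriv lineCutoff t) ^ 2)) := by
  have : Nontrivial (EuclideanSpace ℝ (Fin d)) :=
    Module.nontrivial_of_finrank_pos (R := ℝ) (by simpa using Nat.pos_of_ne_zero hd)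
  rw [setIntegral_congr_fun (measurableSet_singleton _).compl
    fun x hx => hardy_density_logCutoffPow n hx, restrict_compl_singleton,
    integral_fun_norm_addHaar volume (fun r => (r ^ d)⁻¹ *
      ((deriv lineCutoff (Real.log r / n)) ^ 2 / n ^ 2 - ((d : ℝ) - 2) / 2 *
        (2 * lineCutoff (Real.log r / n) * (deriv lineCutoff (Real.log r / n) / n)))),
    finrank_euclideanSpace_fin, nsmul_eq_mul, smul_eq_mul,
    ← integral_lineCutoff_energy (((d : ℝ) - 2) / 2) hn, ← integral_Ioi_inv_mul_comp_log]
  congr 2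
  refine setIntegral_congr_fun measurableSet_Ioi fun r (hr : 0 < r) => ?_
  simp only [smul_eq_mul]
  rw [← mul_assoc, ← Nat.succ_pred_eq_of_ne_zero hd]
  simp only [Nat.succ_eq_add_one, Nat.add_sub_cancel, pow_succ]
  congr 1
  field_simp

/-- On each compact set avoiding the origin the cutoffs are eventually inactive. -/
lemma eventually_logCutoffPow_eqOn {E : Type*} [NormedAddCommGroup E] (s : ℝ) {K : Set E}
    (hK0 : K ⊆ {0}ᶜ) (hK : IsCompact K) :
    ∀ᶠ n : ℝ in atTop, ∀ x ∈ K, logCutoffPow s n ‖x‖ = ‖x‖ ^ (-s) := by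
  have hcont : ContinuousOn (fun x : E => Real.log ‖x‖) K :=
    continuous_norm.continuousOn.log fun x hx => norm_ne_zero_iff.mpr (hK0 hx)
  obtain ⟨C, hC⟩ := hK.exists_bound_of_continuousOn hcont
  filter_upwards [eventually_ge_atTop C, eventually_gt_atTop 0] with n hCn hn x hx
  rw [logCutoffPow, lineCutoff_eq_one, mul_one]
  rw [abs_div, abs_of_pos hn, div_le_one hn]
  exact (hC x hx).trans hCn

/-- The Hardy form on `ℝ^d ∖ {0}`, `d ≥ 3`, admits `|x|^{-(d-2)/2}` as a null state. -/
theorem stmt13 (d : ℕ) (hd : 3 ≤ d) :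
    ∃ φk : ℕ → EuclideanSpace ℝ (Fin d) → ℝ,
      (∀ k, IsSmoothCS ({0}ᶜ : Set (EuclideanSpace ℝ (Fin d))) (φk k)) ∧
      Tendsto (fun k => ∫ x in ({0}ᶜ : Set (EuclideanSpace ℝ (Fin d))),
          (‖gradient (φk k) x‖ ^ 2 - ((d : ℝ) - 2) ^ 2 / 4 * (φk k x) ^ 2 / ‖x‖ ^ 2))
        atTop (nhds 0) ∧
      TendstoL2loc ({0}ᶜ : Set (EuclideanSpace ℝ (Fin d))) φk
        (fun x => ‖x‖ ^ (-((d : ℝ) - 2) / 2)) := by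
  have hscale : Tendsto (fun k : ℕ => (k : ℝ) + 1) atTop atTop :=
    tendsto_atTop_add_const_right _ _ tendsto_natCast_atTop_atTop
  have hpos : ∀ k : ℕ, (0 : ℝ) < k + 1 := fun k => k.cast_add_one_pos
  have hd' : (3 : ℝ) ≤ d := by exact_mod_cast hd
  refine ⟨fun k x => logCutoffPow (((d : ℝ) - 2) / 2) (k + 1) ‖x‖,
    fun k => isSmoothCS_logCutoffPow_norm (by linarith) (hpos k), ?_, fun K hK0 hK => ?_⟩
  · simp only [hardy_energy_logCutoffPow (show d ≠ 0 by omega) (hpos _)]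
    simpa using (((tendsto_inv_atTop_zero.comp hscale).mul_const _).const_mul _).const_mul (d : ℝ)
  · refine tendsto_const_nhds.congr' ?_
    filter_upwards [hscale.eventually (eventually_logCutoffPow_eqOn (((d : ℝ) - 2) / 2) hK0 hK)]
      with k hk
    rw [setIntegral_congr_fun (g := fun _ => (0 : ℝ)) hK.measurableSet fun x hx => ?_]
    · simp
    · simp only [hk x hx, neg_div, sub_self]
      norm_num
end
end
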